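/- arXiv:2507.09787 — 2 statements merged into one kernel-verified Lean document; each statement's English description precedes it below -/
import Mathlib

section
/- Let T > 0, θ₀ ∈ ℝ, α ∈ (0,1], X : [0,T] → ℝ be α-Hölder continuous with constant ‖X‖_{α,T}, ψ : ℝ → ℝ continuous and bounded, and φ : ℝ → ℝ continuously differentiable with φ and φ' bounded. Set 𝔠₁ = |θ₀| ‖φ‖_∞ ‖ψ‖_∞ e^{|θ₀| ‖ψ‖_∞ T}, 𝔠₅ = |θ₀| ‖ψ‖_∞ e^{2|θ₀| ‖ψ‖_∞ T} and 𝔠₆ = 𝔠₅ T^{1−α} (𝔠₁ T^{1−α} + ‖φ'‖_∞). Then with L̄(s,t) = φ(X_t) exp(θ₀ ∫_s^t ψ(X_r) dr), one has |L̄(s,t) − L̄(u,t) − (L̄(s,v) − L̄(u,v))| ≤ 𝔠₆ (max(1, ‖X‖_{α,T})) |s−u|^α |t−v|^α for all s, u, t, v ∈ [0,T]. -/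
open Real intervalIntegral

theorem abs_exp_sub_exp_le {a b M : ℝ} (ha : a ≤ M) (hb : b ≤ M) :
    |Real.exp a - Real.exp b| ≤ Real.exp M * |a - b| := by
  wlog h : b ≤ a generalizing a b
  · rw [abs_sub_comm, abs_sub_comm a b]
    exact this hb ha (not_le.mp h).le
  rw [abs_of_nonneg (sub_nonneg.mpr (Real.exp_le_exp.mpr h)), abs_of_nonneg (sub_nonneg.mpr h)]
  have hsplit : Real.exp b = Real.exp a * Real.exp (b - a) := by
    rw [← Real.exp_add]; ring_nf
  calc Real.exp a - Real.exp b = Real.exp a * (1 - Real.exp (b - a)) := by rw [hsplit]; ring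
    _ ≤ Real.exp a * (a - b) := by
        have := Real.add_one_le_exp (b - a)
        exact mul_le_mul_of_nonneg_left (by linarith) (Real.exp_pos a).le
    _ ≤ Real.exp M * (a - b) :=
        mul_le_mul_of_nonneg_right (Real.exp_le_exp.mpr ha) (sub_nonneg.mpr h)

theorem continuousOn_of_abs_sub_le_rpow {S : Set ℝ} {X : ℝ → ℝ} {C α : ℝ} (hα : 0 < α)
    (hX : ∀ s ∈ S, ∀ t ∈ S, |X t - X s| ≤ C * |t - s| ^ α) : ContinuousOn X S := by
  intro s hs
  rw [ContinuousWithinAt, tendsto_iff_dist_tendsto_zero]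
  have hcont : Continuous fun t : ℝ => C * |t - s| ^ α :=
    continuous_const.mul ((continuous_id.sub continuous_const).abs.rpow_const
      fun _ => Or.inr hα.le)
  have hlim : Filter.Tendsto (fun t : ℝ => C * |t - s| ^ α) (nhdsWithin s S) (nhds 0) := by
    have := (hcont.tendsto s).mono_left (nhdsWithin_le_nhds (s := S))
    simpa [Real.zero_rpow hα.ne'] using this
  refine squeeze_zero' (Filter.Eventually.of_forall fun _ => dist_nonneg) ?_ hlim
  filter_upwards [self_mem_nhdsWithin] with t ht
  exact hX s hs t ht

theorem abs_sub_le_rpow_mul_rpow {T α x y : ℝ} (hα : α ≤ 1)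
    (hx : x ∈ Set.Icc 0 T) (hy : y ∈ Set.Icc 0 T) :
    |x - y| ≤ T ^ (1 - α) * |x - y| ^ α := by
  have hle : |x - y| ≤ T := abs_le.mpr ⟨by linarith [hx.1, hy.2], by linarith [hx.2, hy.1]⟩
  calc |x - y| = |x - y| ^ (1 - α) * |x - y| ^ α := by
        rw [← Real.rpow_add' (abs_nonneg _) (by norm_num)]
        simp
    _ ≤ T ^ (1 - α) * |x - y| ^ α := by
        have : 0 ≤ 1 - α := sub_nonneg.mpr hα
        gcongr

/-- Let `T > 0`, `θ₀ ∈ ℝ`, `α ∈ (0,1]`, `X : [0,T] → ℝ` be `α`-Hölder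
continuous with constant `C_X`, `ψ : ℝ → ℝ` continuous and bounded (by `Kψ`), and
`φ : ℝ → ℝ` continuously differentiable with `φ`, `φ'` bounded (by `Kφ`, `Kφ'`). Set
`𝔠₁ = |θ₀| Kφ Kψ e^{|θ₀| Kψ T}`, `𝔠₅ = |θ₀| Kψ e^{2|θ₀| Kψ T}`,
`𝔠₆ = 𝔠₅ T^{1−α}(𝔠₁ T^{1−α} + Kφ')`. Then with `L̄(s,t) = φ(X_t) exp(θ₀ ∫_s^t ψ(X_r) dr)`,
`|L̄(s,t) − L̄(u,t) − (L̄(s,v) − L̄(u,v))| ≤ 𝔠₆ max(1, C_X) |s−u|^α |t−v|^α`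
for all `s, u, t, v ∈ [0,T]`. -/
theorem stmt9 (T θ₀ α CX Kφ Kφ' Kψ : ℝ) (hT : 0 < T) (hα1 : 0 < α) (hα2 : α ≤ 1)
    (X : ℝ → ℝ)
    (hX : ∀ s ∈ Set.Icc (0:ℝ) T, ∀ t ∈ Set.Icc (0:ℝ) T, |X t - X s| ≤ CX * |t - s| ^ α)
    (ψ : ℝ → ℝ) (hψc : Continuous ψ) (hψb : ∀ y : ℝ, |ψ y| ≤ Kψ)
    (φ φ' : ℝ → ℝ) (hφd : ∀ y : ℝ, HasDerivAt φ (φ' y) y) (hφ'c : Continuous φ')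
    (hφb : ∀ y : ℝ, |φ y| ≤ Kφ) (hφ'b : ∀ y : ℝ, |φ' y| ≤ Kφ')
    (s u t v : ℝ) (hs : s ∈ Set.Icc 0 T) (hu : u ∈ Set.Icc 0 T)
    (ht : t ∈ Set.Icc 0 T) (hv : v ∈ Set.Icc 0 T) :
    |φ (X t) * Real.exp (θ₀ * ∫ r in s..t, ψ (X r))
        - φ (X t) * Real.exp (θ₀ * ∫ r in u..t, ψ (X r))
        - (φ (X v) * Real.exp (θ₀ * ∫ r in s..v, ψ (X r))
            - φ (X v) * Real.exp (θ₀ * ∫ r in u..v, ψ (X r)))| ≤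
      (|θ₀| * Kψ * Real.exp (2 * |θ₀| * Kψ * T)) * T ^ (1 - α)
          * ((|θ₀| * Kφ * Kψ * Real.exp (|θ₀| * Kψ * T)) * T ^ (1 - α) + Kφ')
        * max 1 CX * |s - u| ^ α * |t - v| ^ α := by
  have h0 : (0 : ℝ) ∈ Set.Icc 0 T := ⟨le_rfl, hT.le⟩
  have hKψ : 0 ≤ Kψ := (abs_nonneg _).trans (hψb 0)
  have hKφ : 0 ≤ Kφ := (abs_nonneg _).trans (hφb 0)
  have hKφ' : 0 ≤ Kφ' := (abs_nonneg _).trans (hφ'b 0)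
  have hcont : ContinuousOn (fun r => ψ (X r)) (Set.Icc 0 T) :=
    hψc.comp_continuousOn (continuousOn_of_abs_sub_le_rpow hα1 hX)
  have hint : ∀ a ∈ Set.Icc 0 T, ∀ b ∈ Set.Icc 0 T,
      IntervalIntegrable (fun r => ψ (X r)) MeasureTheory.volume a b := fun a ha b hb =>
    (hcont.mono (Set.uIcc_subset_Icc ha hb)).intervalIntegrable
  set A : ℝ → ℝ := fun x => θ₀ * ∫ r in (0 : ℝ)..x, ψ (X r) with hA
  have hsub : ∀ a ∈ Set.Icc 0 T, ∀ b ∈ Set.Icc 0 T,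
      θ₀ * ∫ r in a..b, ψ (X r) = A b - A a := by
    intro a ha b hb
    rw [hA, ← mul_sub, integral_interval_sub_left (hint 0 h0 b hb) (hint 0 h0 a ha)]
  have hlip : ∀ a ∈ Set.Icc 0 T, ∀ b ∈ Set.Icc 0 T, |A b - A a| ≤ |θ₀| * Kψ * |b - a| := by
    intro a ha b hb
    rw [← hsub a ha b hb, abs_mul, mul_assoc]
    gcongr
    exact norm_integral_le_of_norm_le_const (f := fun r => ψ (X r)) fun r _ => hψb (X r)
  have hbound : ∀ a ∈ Set.Icc 0 T, |A a| ≤ |θ₀| * Kψ * T := by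
    intro a ha
    calc |A a| ≤ |θ₀| * Kψ * |a - 0| := by simpa [hA] using hlip 0 h0 a ha
      _ ≤ |θ₀| * Kψ * T := by
          rw [sub_zero, abs_of_nonneg ha.1]
          gcongr
          exact ha.2
  set M : ℝ := |θ₀| * Kψ * T with hM
  have hM0 : 0 ≤ M := by positivity
  have hφlip : |φ (X t) - φ (X v)| ≤ Kφ' * |X t - X v| :=
    Convex.norm_image_sub_le_of_norm_hasDerivWithin_le
      (fun y _ => (hφd y).hasDerivWithinAt) (fun y _ => hφ'b y) convex_univ
      (Set.mem_univ _) (Set.mem_univ _)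
  have hfactor_su : |Real.exp (-A s) - Real.exp (-A u)| ≤
      Real.exp M * (|θ₀| * Kψ * (T ^ (1 - α) * |s - u| ^ α)) := by
    refine (abs_exp_sub_exp_le ((neg_le_abs _).trans (hbound s hs))
      ((neg_le_abs _).trans (hbound u hu))).trans ?_
    gcongr
    rw [neg_sub_neg, abs_sub_comm]
    exact (hlip u hu s hs).trans (by gcongr; exact abs_sub_le_rpow_mul_rpow hα2 hs hu)
  have hfactor_tv : |φ (X t) * Real.exp (A t) - φ (X v) * Real.exp (A v)| ≤
      Real.exp M * ((|θ₀| * Kφ * Kψ * Real.exp M) * T ^ (1 - α) + Kφ') * max 1 CX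
        * |t - v| ^ α := by
    have hexp : |Real.exp (A t) - Real.exp (A v)| ≤
        Real.exp M * (|θ₀| * Kψ * (T ^ (1 - α) * |t - v| ^ α)) := by
      refine (abs_exp_sub_exp_le ((le_abs_self _).trans (hbound t ht))
        ((le_abs_self _).trans (hbound v hv))).trans ?_
      gcongr
      exact (hlip v hv t ht).trans (by gcongr; exact abs_sub_le_rpow_mul_rpow hα2 ht hv)
    have hXtv : |X t - X v| ≤ max 1 CX * |t - v| ^ α :=
      (hX v hv t ht).trans (by gcongr; exact le_max_right _ _)
    have hexp_le : Real.exp (A t) ≤ Real.exp M :=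
      Real.exp_le_exp.mpr ((le_abs_self _).trans (hbound t ht))
    have hone : (1 : ℝ) ≤ Real.exp M * max 1 CX :=
      one_le_mul_of_one_le_of_one_le (Real.one_le_exp hM0) (le_max_left _ _)
    calc |φ (X t) * Real.exp (A t) - φ (X v) * Real.exp (A v)|
        = |(φ (X t) - φ (X v)) * Real.exp (A t)
            + φ (X v) * (Real.exp (A t) - Real.exp (A v))| := by ring_nf
      _ ≤ |φ (X t) - φ (X v)| * Real.exp (A t)
            + |φ (X v)| * |Real.exp (A t) - Real.exp (A v)| := by
          refine (abs_add_le _ _).trans_eq ?_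
          rw [abs_mul, abs_mul, Real.abs_exp]
      _ ≤ (Kφ' * (max 1 CX * |t - v| ^ α)) * Real.exp M
            + Kφ * (Real.exp M * (|θ₀| * Kψ * (T ^ (1 - α) * |t - v| ^ α))) * 1 := by
          rw [mul_one]
          gcongr
          · exact hφlip.trans (by gcongr)
          · exact hφb _
      _ ≤ (Kφ' * (max 1 CX * |t - v| ^ α)) * Real.exp M
            + Kφ * (Real.exp M * (|θ₀| * Kψ * (T ^ (1 - α) * |t - v| ^ α)))
              * (Real.exp M * max 1 CX) := by gcongr
      _ = _ := by ring
  rw [hsub s hs t ht, hsub u hu t ht, hsub s hs v hv, hsub u hu v hv]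
  have hexp2 : Real.exp (2 * |θ₀| * Kψ * T) = Real.exp M * Real.exp M := by
    rw [← Real.exp_add, hM]; ring_nf
  simp only [sub_eq_add_neg (A _), Real.exp_add]
  calc _ = |φ (X t) * Real.exp (A t) - φ (X v) * Real.exp (A v)|
        * |Real.exp (-A s) - Real.exp (-A u)| := by rw [← abs_mul]; ring_nf
    _ ≤ _ := mul_le_mul hfactor_tv hfactor_su (abs_nonneg _) (by positivity)
    _ = _ := by rw [hexp2]; ring
end

section
/- Let T > 0, θ₀ ∈ ℝ, p ≥ 1 and set α = 1/p. Let X : [0,T] → ℝ be α-Hölder continuous with constant ‖X‖_{α,T}, ψ : ℝ → ℝ continuous and bounded, and φ : ℝ → ℝ continuously differentiable with φ and φ' bounded. Set 𝔠₂ = |θ₀| e^{|θ₀| ‖ψ‖_∞ T}, 𝔠₃ = max( 𝔠₂ ‖φ‖_∞ ‖ψ‖_∞ , ‖φ'‖_∞ (1 + e^{|θ₀| ‖ψ‖_∞ T}) + 𝔠₂ ‖φ‖_∞ ‖ψ‖_∞ T^{1−α} ) and 𝔠₄ = 𝔠₃ + ‖φ'‖_∞. Then with L̄(s,t) = φ(X_t)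 exp(θ₀ ∫_s^t ψ(X_r) dr), for every dissection 0 = t_0 ≤ t_1 ≤ ⋯ ≤ t_n = T, Σ_{j=0}^{n−1} |L̄(0, t_{j+1}) − L̄(0, t_j)|^p ≤ 𝔠₄^p T (max(1, ‖X‖_{α,T}))^p. In particular the p-variation of t ↦ L̄(0,t) on [0,T] is at most 𝔠₄ T^{1/p} max(1, ‖X‖_{α,T}). -/
open Real intervalIntegral

theorem abs_exp_sub_exp_le_s10 {x y R : ℝ} (hx : x ≤ R) (hy : y ≤ R) :
    |Real.exp x - Real.exp y| ≤ Real.exp R * |x - y| := by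
  wlog h : y ≤ x generalizing x y
  · rw [abs_sub_comm, abs_sub_comm x]
    exact this hy hx (le_of_not_ge h)
  rw [abs_of_nonneg (sub_nonneg.2 (Real.exp_le_exp.2 h)), abs_of_nonneg (sub_nonneg.2 h)]
  have h1 : Real.exp y = Real.exp x * Real.exp (y - x) := by
    rw [← Real.exp_add]; congr 1; ring
  have h2 := Real.add_one_le_exp (y - x)
  calc Real.exp x - Real.exp y = Real.exp x * (1 - Real.exp (y - x)) := by rw [h1]; ring
    _ ≤ Real.exp x * (x - y) := mul_le_mul_of_nonneg_left (by linarith) (Real.exp_pos x).le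
    _ ≤ Real.exp R * (x - y) :=
      mul_le_mul_of_nonneg_right (Real.exp_le_exp.2 hx) (sub_nonneg.2 h)

theorem continuousOn_of_abs_sub_le_mul_rpow {X : ℝ → ℝ} {C α : ℝ} {S : Set ℝ} (hα : 0 < α)
    (hX : ∀ s ∈ S, ∀ t ∈ S, |X t - X s| ≤ C * |t - s| ^ α) : ContinuousOn X S := by
  intro s hs
  rw [ContinuousWithinAt, tendsto_iff_dist_tendsto_zero]
  have hlim : Filter.Tendsto (fun t : ℝ => C * |t - s| ^ α) (nhdsWithin s S) (nhds 0) := by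
    have hc : Continuous fun t : ℝ => C * |t - s| ^ α :=
      continuous_const.mul
        (((continuous_id.sub continuous_const).abs).rpow_const fun _ => Or.inr hα.le)
    have h0 := (hc.tendsto s).mono_left (nhdsWithin_le_nhds (s := S))
    simpa [Real.zero_rpow hα.ne'] using h0
  refine squeeze_zero' (Filter.Eventually.of_forall fun _ => dist_nonneg) ?_ hlim
  filter_upwards [self_mem_nhdsWithin] with t ht
  rw [Real.dist_eq]
  exact hX s hs t ht

theorem abs_integral_le_of_abs_le {f : ℝ → ℝ} {K a b : ℝ} (hab : a ≤ b) (hf : ∀ r, |f r| ≤ K) :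
    |∫ r in a..b, f r| ≤ K * (b - a) := by
  have h := intervalIntegral.norm_integral_le_of_norm_le_const (a := a) (b := b) (f := f) (C := K)
    fun r _ => hf r
  rwa [Real.norm_eq_abs, abs_of_nonneg (sub_nonneg.2 hab)] at h

/-- The Hölder bound for the increments of `φ(X_t) exp(θ ∫_0^t ψ(X_r) dr)`. -/
theorem abs_weighted_increment_le {T θ α CX Kφ Kφ' Kψ : ℝ} (hα0 : 0 < α) (hα1 : α ≤ 1)
    {X ψ φ φ' : ℝ → ℝ}
    (hX : ∀ s ∈ Set.Icc (0:ℝ) T, ∀ t ∈ Set.Icc (0:ℝ) T, |X t - X s| ≤ CX * |t - s| ^ α)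
    (hψc : Continuous ψ) (hψb : ∀ y : ℝ, |ψ y| ≤ Kψ)
    (hφd : ∀ y : ℝ, HasDerivAt φ (φ' y) y)
    (hφb : ∀ y : ℝ, |φ y| ≤ Kφ) (hφ'b : ∀ y : ℝ, |φ' y| ≤ Kφ')
    {a b : ℝ} (ha : 0 ≤ a) (hab : a ≤ b) (hb : b ≤ T) :
    |φ (X b) * Real.exp (θ * ∫ r in (0:ℝ)..b, ψ (X r))
        - φ (X a) * Real.exp (θ * ∫ r in (0:ℝ)..a, ψ (X r))| ≤
      (Kφ' * Real.exp (|θ| * Kψ * T) * CX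
        + |θ| * Real.exp (|θ| * Kψ * T) * Kφ * Kψ * T ^ (1 - α)) * (b - a) ^ α := by
  have hKφ : 0 ≤ Kφ := (abs_nonneg _).trans (hφb 0)
  have hKφ' : 0 ≤ Kφ' := (abs_nonneg _).trans (hφ'b 0)
  have hKψ : 0 ≤ Kψ := (abs_nonneg _).trans (hψb 0)
  have hba : 0 ≤ b - a := sub_nonneg.2 hab
  have hcont : ContinuousOn (fun r => ψ (X r)) (Set.Icc 0 T) :=
    hψc.comp_continuousOn (continuousOn_of_abs_sub_le_mul_rpow hα0 hX)
  have hψX : ∀ c, 0 ≤ c → c ≤ T →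
      IntervalIntegrable (fun r => ψ (X r)) MeasureTheory.volume 0 c := fun c h0 hc =>
    (hcont.mono (Set.Icc_subset_Icc le_rfl hc)).intervalIntegrable_of_Icc h0
  have hexp : ∀ c, 0 ≤ c → c ≤ T → θ * (∫ r in (0:ℝ)..c, ψ (X r)) ≤ |θ| * Kψ * T := by
    intro c h0 hc
    have h1 := abs_integral_le_of_abs_le h0 fun r => hψb (X r)
    calc θ * (∫ r in (0:ℝ)..c, ψ (X r)) ≤ |θ| * |∫ r in (0:ℝ)..c, ψ (X r)| := by
          rw [← abs_mul]; exact le_abs_self _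
      _ ≤ |θ| * (Kψ * (c - 0)) := by gcongr
      _ ≤ |θ| * (Kψ * T) := by gcongr; linarith
      _ = |θ| * Kψ * T := by ring
  have hφL : |φ (X b) - φ (X a)| ≤ Kφ' * |X b - X a| := by
    have h := Convex.norm_image_sub_le_of_norm_hasDerivWithin_le (f := φ) (f' := φ')
      (s := Set.univ) (C := Kφ') (x := X a) (y := X b)
      (fun y _ => (hφd y).hasDerivWithinAt) (fun y _ => hφ'b y) convex_univ trivial trivial
    simpa [Real.norm_eq_abs] using h
  have hXab : |X b - X a| ≤ CX * (b - a) ^ α := by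
    have h := hX a ⟨ha, hab.trans hb⟩ b ⟨ha.trans hab, hb⟩
    rwa [abs_of_nonneg hba] at h
  have hE := abs_exp_sub_exp_le_s10 (hexp b (ha.trans hab) hb) (hexp a ha (hab.trans hb))
  have hI : |θ * (∫ r in (0:ℝ)..b, ψ (X r)) - θ * ∫ r in (0:ℝ)..a, ψ (X r)|
      ≤ |θ| * (Kψ * (b - a)) := by
    rw [← mul_sub, abs_mul, intervalIntegral.integral_interval_sub_left
      (hψX b (ha.trans hab) hb) (hψX a ha (hab.trans hb))]
    gcongr
    exact abs_integral_le_of_abs_le hab fun r => hψb (X r)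
  have hEb := Real.exp_le_exp.2 (hexp b (ha.trans hab) hb)
  have hpow : b - a ≤ (b - a) ^ α * T ^ (1 - α) := by
    calc b - a = (b - a) ^ α * (b - a) ^ (1 - α) := by
          rw [← Real.rpow_add' hba (by norm_num)]; norm_num
      _ ≤ (b - a) ^ α * T ^ (1 - α) := by
          gcongr
          linarith
  have hEb0 := (Real.exp_pos (θ * ∫ r in (0:ℝ)..b, ψ (X r))).le
  generalize Real.exp (|θ| * Kψ * T) = E at *
  generalize Real.exp (θ * ∫ r in (0:ℝ)..b, ψ (X r)) = Eb at *
  generalize Real.exp (θ * ∫ r in (0:ℝ)..a, ψ (X r)) = Ea at *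
  have hE0 : 0 ≤ E := hEb0.trans hEb
  calc |φ (X b) * Eb - φ (X a) * Ea|
      = |(φ (X b) - φ (X a)) * Eb + φ (X a) * (Eb - Ea)| := by congr 1; ring
    _ ≤ |φ (X b) - φ (X a)| * Eb + |φ (X a)| * |Eb - Ea| := by
        refine (abs_add_le _ _).trans ?_
        rw [abs_mul, abs_mul, abs_of_nonneg hEb0]
    _ ≤ (Kφ' * (CX * (b - a) ^ α)) * E
          + Kφ * (E * (|θ| * (Kψ * ((b - a) ^ α * T ^ (1 - α))))) := by
        gcongr
        · exact mul_nonneg hKφ' ((abs_nonneg _).trans hXab)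
        · exact hφL.trans (by gcongr)
        · exact hφb _
        · exact hE.trans (by gcongr; exact hI.trans (by gcongr))
    _ = _ := by ring

/-- Let `T > 0`, `θ₀ ∈ ℝ`, `p ≥ 1`, `α = 1/p`, `X : [0,T] → ℝ` `α`-Hölder
continuous with constant `C_X`, `ψ : ℝ → ℝ` continuous and bounded (by `Kψ`), and `φ`
continuously differentiable with `φ`, `φ'` bounded (by `Kφ`, `Kφ'`). With
`𝔠₂ = |θ₀| e^{|θ₀| Kψ T}`,
`𝔠₃ = max(𝔠₂ Kφ Kψ, Kφ'(1 + e^{|θ₀| Kψ T}) + 𝔠₂ Kφ Kψ T^{1−α})`, `𝔠₄ = 𝔠₃ + Kφ'`,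
and `L̄(s,t) = φ(X_t) exp(θ₀ ∫_s^t ψ(X_r) dr)`, for every dissection
`0 = t_0 ≤ ⋯ ≤ t_n = T`,
`Σ_{j<n} |L̄(0,t_{j+1}) − L̄(0,t_j)|^p ≤ 𝔠₄^p T max(1,C_X)^p`; in particular
`(Σ_{j<n} |L̄(0,t_{j+1}) − L̄(0,t_j)|^p)^{1/p} ≤ 𝔠₄ T^{1/p} max(1,C_X)`. -/
theorem stmt10 (T θ₀ p α CX Kφ Kφ' Kψ : ℝ) (hT : 0 < T) (hp : 1 ≤ p) (hα : α = 1/p)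
    (X : ℝ → ℝ)
    (hX : ∀ s ∈ Set.Icc (0:ℝ) T, ∀ t ∈ Set.Icc (0:ℝ) T, |X t - X s| ≤ CX * |t - s| ^ α)
    (ψ : ℝ → ℝ) (hψc : Continuous ψ) (hψb : ∀ y : ℝ, |ψ y| ≤ Kψ)
    (φ φ' : ℝ → ℝ) (hφd : ∀ y : ℝ, HasDerivAt φ (φ' y) y) (hφ'c : Continuous φ')
    (hφb : ∀ y : ℝ, |φ y| ≤ Kφ) (hφ'b : ∀ y : ℝ, |φ' y| ≤ Kφ')
    (n : ℕ) (t : ℕ → ℝ) (ht0 : t 0 = 0) (htn : t n = T)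
    (hmono : ∀ j < n, t j ≤ t (j+1)) :
    (∑ j ∈ Finset.range n,
        |φ (X (t (j+1))) * Real.exp (θ₀ * ∫ r in (0:ℝ)..(t (j+1)), ψ (X r))
          - φ (X (t j)) * Real.exp (θ₀ * ∫ r in (0:ℝ)..(t j), ψ (X r))| ^ p) ≤
      (max (|θ₀| * Real.exp (|θ₀| * Kψ * T) * Kφ * Kψ)
            (Kφ' * (1 + Real.exp (|θ₀| * Kψ * T))
              + |θ₀| * Real.exp (|θ₀| * Kψ * T) * Kφ * Kψ * T ^ (1 - α)) + Kφ') ^ p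
        * T * (max 1 CX) ^ p ∧
    (∑ j ∈ Finset.range n,
        |φ (X (t (j+1))) * Real.exp (θ₀ * ∫ r in (0:ℝ)..(t (j+1)), ψ (X r))
          - φ (X (t j)) * Real.exp (θ₀ * ∫ r in (0:ℝ)..(t j), ψ (X r))| ^ p) ^ (1/p) ≤
      (max (|θ₀| * Real.exp (|θ₀| * Kψ * T) * Kφ * Kψ)
            (Kφ' * (1 + Real.exp (|θ₀| * Kψ * T))
              + |θ₀| * Real.exp (|θ₀| * Kψ * T) * Kφ * Kψ * T ^ (1 - α)) + Kφ')
        * T ^ (1/p) * max 1 CX := by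
  have hα0 : 0 < α := by rw [hα]; positivity
  have hα1 : α ≤ 1 := by rw [hα]; exact (div_le_one (by linarith)).2 hp
  have hp0 : 0 < p := by linarith
  have hKφ : 0 ≤ Kφ := (abs_nonneg _).trans (hφb 0)
  have hKφ' : 0 ≤ Kφ' := (abs_nonneg _).trans (hφ'b 0)
  have hKψ : 0 ≤ Kψ := (abs_nonneg _).trans (hψb 0)
  have hle : ∀ i j, i ≤ j → j ≤ n → t i ≤ t j := by
    intro i j hij
    induction j, hij using Nat.le_induction with
    | base => intro _; exact le_rfl
    | succ j _ ih => intro hj; exact (ih (by omega)).trans (hmono j (by omega))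
  set E := Real.exp (|θ₀| * Kψ * T) with hE
  have hE0 : 0 < E := Real.exp_pos _
  set c := max (|θ₀| * E * Kφ * Kψ) (Kφ' * (1 + E) + |θ₀| * E * Kφ * Kψ * T ^ (1 - α)) + Kφ'
    with hc
  set M := max 1 CX with hM
  have hM1 : 1 ≤ M := le_max_left _ _
  have hMC : CX ≤ M := le_max_right _ _
  have hD : 0 ≤ |θ₀| * E * Kφ * Kψ * T ^ (1 - α) := by positivity
  have hcle : Kφ' * E + |θ₀| * E * Kφ * Kψ * T ^ (1 - α) ≤ c := by
    have := le_max_right (|θ₀| * E * Kφ * Kψ)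
      (Kφ' * (1 + E) + |θ₀| * E * Kφ * Kψ * T ^ (1 - α))
    rw [hc]; linarith
  have hc0 : 0 ≤ c := le_trans (by positivity) hcle
  have hcoef : Kφ' * E * CX + |θ₀| * E * Kφ * Kψ * T ^ (1 - α) ≤ c * M := by
    calc _ ≤ Kφ' * E * M + |θ₀| * E * Kφ * Kψ * T ^ (1 - α) * M := by
          exact add_le_add (by gcongr) (le_mul_of_one_le_right hD hM1)
      _ = (Kφ' * E + |θ₀| * E * Kφ * Kψ * T ^ (1 - α)) * M := by ring
      _ ≤ c * M := by gcongr
  have hsum : (∑ j ∈ Finset.range n,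
        |φ (X (t (j+1))) * Real.exp (θ₀ * ∫ r in (0:ℝ)..(t (j+1)), ψ (X r))
          - φ (X (t j)) * Real.exp (θ₀ * ∫ r in (0:ℝ)..(t j), ψ (X r))| ^ p) ≤
      c ^ p * T * M ^ p := by
    calc _ ≤ ∑ j ∈ Finset.range n, c ^ p * M ^ p * (t (j+1) - t j) := by
          refine Finset.sum_le_sum fun j hj => ?_
          have hj := Finset.mem_range.1 hj
          have hd : 0 ≤ t (j+1) - t j := sub_nonneg.2 (hmono j hj)
          have h := abs_weighted_increment_le (θ := θ₀) hα0 hα1 hX hψc hψb hφd hφb hφ'b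
            (ht0 ▸ hle 0 j (by omega) hj.le) (hmono j hj) (htn ▸ hle (j+1) n hj le_rfl)
          calc _ ≤ (c * M * (t (j+1) - t j) ^ α) ^ p :=
                Real.rpow_le_rpow (abs_nonneg _) (h.trans (by gcongr)) hp0.le
            _ = c ^ p * M ^ p * (t (j+1) - t j) := by
                rw [Real.mul_rpow (by positivity) (by positivity),
                  Real.mul_rpow hc0 (by positivity), ← Real.rpow_mul hd, hα,
                  one_div_mul_cancel hp0.ne', Real.rpow_one]
      _ = c ^ p * T * M ^ p := by
          rw [← Finset.mul_sum, Finset.sum_range_sub, htn, ht0]; ring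
  refine ⟨hsum, ?_⟩
  calc _ ≤ (c ^ p * T * M ^ p) ^ (1/p) :=
        Real.rpow_le_rpow (Finset.sum_nonneg fun _ _ => by positivity) hsum (by positivity)
    _ = c * T ^ (1/p) * M := by
        rw [Real.mul_rpow (by positivity) (by positivity),
          Real.mul_rpow (by positivity) hT.le, ← Real.rpow_mul hc0,
          ← Real.rpow_mul (by positivity), mul_one_div_cancel hp0.ne', Real.rpow_one,
          Real.rpow_one]
end
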